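/- arXiv:2102.07428 — 7 statements merged into one kernel-verified Lean document; each statement's English description precedes it below -/
import Mathlib

section
/- For the vector fields N₀, N₁, N₂, N₃ and W₁, W₂, W₃ on ℝ⁷, where Wᵢ(x,ℓ,y) = (0, 0, eᵢ), the pointwise Lie bracket [X,Y](q) = (DY)_q(X(q)) − (DX)_q(Y(q)) (with DY the Fréchet derivative) satisfies: [N₀, Nᵢ] = Wᵢ for i = 1,2,3, [Nᵢ, Nⱼ] = 0 for i, j ∈ {1,2,3}, and [N_j, W_k] = [W_i, W_k] = 0 for all j ∈ {0,1,2,3} and i, k ∈ {1,2,3}. -/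
/-- `ℝ⁷` viewed as `ℝ × ℝ³ × ℝ³`. -/
abbrev Ngrp : Type := ℝ × (Fin 3 → ℝ) × (Fin 3 → ℝ)

/-- The pointwise Lie bracket of vector fields:
`[X,Y](q) = (DY)_q(X(q)) − (DX)_q(Y(q))` with `D` the Fréchet derivative. -/
noncomputable def VFbracket (X Y : Ngrp → Ngrp) : Ngrp → Ngrp :=
  fun q => fderiv ℝ Y q (X q) - fderiv ℝ X q (Y q)

/-- The vector field `N₀(x,ℓ,y) = (1, 0, −ℓ/2)`. -/
noncomputable def N₀ (q : Ngrp) : Ngrp := (1, 0, -(1 / 2 : ℝ) • q.2.1)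

/-- The vector fields `Nᵢ(x,ℓ,y) = (0, eᵢ, (x/2)·eᵢ)`, `i = 1,2,3`. -/
noncomputable def NV (i : Fin 3) (q : Ngrp) : Ngrp := (0, (Pi.single i 1 : Fin 3 → ℝ), (q.1 / 2) • (Pi.single i 1 : Fin 3 → ℝ))

/-- The constant vector fields `Wᵢ(x,ℓ,y) = (0, 0, eᵢ)`, `i = 1,2,3`. -/
noncomputable def WV (i : Fin 3) (_q : Ngrp) : Ngrp := (0, 0, (Pi.single i 1 : Fin 3 → ℝ))

theorem fderiv_N₀_apply (q v : Ngrp) :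
    fderiv ℝ N₀ q v = (0, 0, -(1 / 2 : ℝ) • v.2.1) := by
  have hy : HasFDerivAt (fun p : Ngrp => -(1 / 2 : ℝ) • p.2.1) _ q :=
    (hasFDerivAt_snd (𝕜 := ℝ) (p := q)).fst.const_smul (-(1 / 2 : ℝ))
  have h : HasFDerivAt N₀ _ q :=
    (hasFDerivAt_const (1 : ℝ) q).prodMk ((hasFDerivAt_const (0 : Fin 3 → ℝ) q).prodMk hy)
  rw [h.fderiv]
  rfl

theorem fderiv_NV_apply (i : Fin 3) (q v : Ngrp) :
    fderiv ℝ (NV i) q v = (0, 0, (v.1 / 2) • (Pi.single i 1 : Fin 3 → ℝ)) := by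
  have hy : HasFDerivAt (fun p : Ngrp => (p.1 / 2) • (Pi.single i 1 : Fin 3 → ℝ)) _ q :=
    ((hasFDerivAt_fst (𝕜 := ℝ) (p := q)).mul_const (2 : ℝ)⁻¹).smul_const _
  have h : HasFDerivAt (NV i) _ q :=
    (hasFDerivAt_const (0 : ℝ) q).prodMk
      ((hasFDerivAt_const (Pi.single i 1 : Fin 3 → ℝ) q).prodMk hy)
  rw [h.fderiv]
  simp [div_eq_inv_mul]

theorem fderiv_WV_apply (i : Fin 3) (q v : Ngrp) : fderiv ℝ (WV i) q v = 0 := by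
  change fderiv ℝ (fun _ : Ngrp => ((0 : ℝ), (0 : Fin 3 → ℝ), (Pi.single i 1 : Fin 3 → ℝ))) q v = 0
  simp

/-- The bracket relations: `[N₀, Nᵢ] = Wᵢ`, `[Nᵢ, Nⱼ] = 0`, and all the fields `Wᵢ`
bracket trivially with everything. -/
theorem bracket_relations :
    (∀ i : Fin 3, VFbracket N₀ (NV i) = WV i) ∧
    (∀ i j : Fin 3, VFbracket (NV i) (NV j) = 0) ∧
    (∀ k : Fin 3, VFbracket N₀ (WV k) = 0) ∧
    (∀ j k : Fin 3, VFbracket (NV j) (WV k) = 0) ∧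
    (∀ i k : Fin 3, VFbracket (WV i) (WV k) = 0) := by
  refine ⟨fun i => ?_, fun i j => ?_, fun k => ?_, fun j k => ?_, fun i k => ?_⟩ <;> funext q <;>
    simp only [VFbracket, fderiv_N₀_apply, fderiv_NV_apply, fderiv_WV_apply]
  · simp only [N₀, NV, WV, Prod.mk_sub_mk, sub_zero, ← sub_smul]
    norm_num
  all_goals simp [NV, WV]
end

section
/- Let K₁, K₂, K₃ ∈ ℝ with K = √(K₁² + K₂² + K₃²) > 0 and let C₁, C₂, C₃, C₄ ∈ ℝ. Define h₀(t) = K(−C₁ sin(Kt) + C₂ cos(Kt)) and (h₁,h₂,h₃)(t) = (C₁ cos(Kt) + C₂ sin(Kt))·(K₁,K₂,K₃) + (−C₃K₃ − C₄K₂, C₄K₁, C₃K₁). Then these functions solve the fiber system: h₀'(t) = −(K₁h₁(t) + K₂h₂(t) + K₃h₃(t)) and hᵢ'(t) = Kᵢ·h₀(t) for i = 1, 2, 3 and all t ∈ ℝ. -/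
open Real

/-- The harmonic oscillation of frequency `K` with coefficients `a`, `b`, and its derivative. -/
theorem hasDerivAt_cos_add_sin (K a b t : ℝ) :
    HasDerivAt (fun t => a * Real.cos (K * t) + b * Real.sin (K * t))
      (K * (-a * Real.sin (K * t) + b * Real.cos (K * t))) t := by
  have hlin : HasDerivAt (fun t => K * t) K t := by
    simpa using (hasDerivAt_id t).const_mul K
  exact ((hlin.cos.const_mul a).add (hlin.sin.const_mul b)).congr_deriv (by ring)

/-- The explicit functions of Proposition `vert-p` solve the fiber system
`h₀' = −(K₁h₁ + K₂h₂ + K₃h₃)`, `hᵢ' = Kᵢh₀`. -/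
theorem fiber_system_solution (K₁ K₂ K₃ C₁ C₂ C₃ C₄ K : ℝ)
    (hK : K = Real.sqrt (K₁ ^ 2 + K₂ ^ 2 + K₃ ^ 2)) (hKpos : 0 < K) :
    let h₀ : ℝ → ℝ := fun t => K * (-C₁ * Real.sin (K * t) + C₂ * Real.cos (K * t))
    let h₁ : ℝ → ℝ := fun t =>
      (C₁ * Real.cos (K * t) + C₂ * Real.sin (K * t)) * K₁ + (-C₃ * K₃ - C₄ * K₂)
    let h₂ : ℝ → ℝ := fun t =>
      (C₁ * Real.cos (K * t) + C₂ * Real.sin (K * t)) * K₂ + C₄ * K₁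
    let h₃ : ℝ → ℝ := fun t =>
      (C₁ * Real.cos (K * t) + C₂ * Real.sin (K * t)) * K₃ + C₃ * K₁
    ∀ t : ℝ,
      HasDerivAt h₀ (-(K₁ * h₁ t + K₂ * h₂ t + K₃ * h₃ t)) t ∧
      HasDerivAt h₁ (K₁ * h₀ t) t ∧
      HasDerivAt h₂ (K₂ * h₀ t) t ∧
      HasDerivAt h₃ (K₃ * h₀ t) t := by
  intro h₀ h₁ h₂ h₃ t
  have hsq : K ^ 2 = K₁ ^ 2 + K₂ ^ 2 + K₃ ^ 2 := by
    rw [hK, Real.sq_sqrt (by positivity)]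
  have hosc := hasDerivAt_cos_add_sin K C₁ C₂ t
  refine ⟨?_, ?_, ?_, ?_⟩
  · have hderiv := (hasDerivAt_cos_add_sin K C₂ (-C₁) t).const_mul K
    have hfun : h₀ = fun t => K * (C₂ * Real.cos (K * t) + -C₁ * Real.sin (K * t)) := by
      funext s
      simp only [h₀]
      ring
    rw [hfun]
    refine hderiv.congr_deriv ?_
    simp only [h₁, h₂, h₃]
    linear_combination (-C₁ * Real.cos (K * t) - C₂ * Real.sin (K * t)) * hsq
  · exact ((hosc.mul_const K₁).add_const _).congr_deriv (mul_comm _ _)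
  · exact ((hosc.mul_const K₂).add_const _).congr_deriv (mul_comm _ _)
  · exact ((hosc.mul_const K₃).add_const _).congr_deriv (mul_comm _ _)
end

section
/- Let K₁, K₂, K₃ ∈ ℝ with K = √(K₁² + K₂² + K₃²) > 0 and C₁, C₂, C₃, C₄ ∈ ℝ. Define x(t) = C₁ cos(Kt) + C₂ sin(Kt) − C₁, ℓ(t) = (1/K)(C₁ sin(Kt) − C₂ cos(Kt) + C₂)·(K₁,K₂,K₃) + t·(−C₃K₃ − C₄K₂, C₄K₁, C₃K₁), and y(t) = (1/(2K))(C₁² + C₂²)(tK − sin(Kt))·(K₁,K₂,K₃) + (1/(2K))((2C₁ − C₂Kt) sin(Kt) − (C₁Kt + 2C₂) cos(Kt) + 2C₂ − tC₁K)·(−C₃K₃ − C₄K₂, C₄K₁, C₃K₁). Then x(0) = 0, ℓ(0) = 0, y(0) = 0, and for all t ∈ ℝ: x'(t) = h₀(t), ℓᵢ'(t) = hᵢ(t), and yᵢ'(t) = (1/2)(x(t)hᵢ(t) − h₀(t)ℓᵢ(t)) for i = 1, 2, 3, where h₀(t) = K(−C₁ sin(Kt) + C₂ cos(Kt)) and (h₁,h₂,h₃)(t)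 = (C₁ cos(Kt) + C₂ sin(Kt))·(K₁,K₂,K₃) + (−C₃K₃ − C₄K₂, C₄K₁, C₃K₁). -/
open Real

/-- The explicit curves of Proposition `geodesics` start at the origin and solve the base
system `x' = h₀`, `ℓ' = h`, `y' = (1/2)(x·h − h₀·ℓ)` with the explicit controls `h₀, h`. -/
theorem base_system_solution (K₁ K₂ K₃ C₁ C₂ C₃ C₄ K : ℝ)
    (hK : K = Real.sqrt (K₁ ^ 2 + K₂ ^ 2 + K₃ ^ 2)) (hKpos : 0 < K) :
    let Kv : Fin 3 → ℝ := ![K₁, K₂, K₃]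
    let z₂ : Fin 3 → ℝ := ![-C₃ * K₃ - C₄ * K₂, C₄ * K₁, C₃ * K₁]
    let x : ℝ → ℝ := fun t => C₁ * Real.cos (K * t) + C₂ * Real.sin (K * t) - C₁
    let ℓ : ℝ → (Fin 3 → ℝ) := fun t =>
      ((1 / K) * (C₁ * Real.sin (K * t) - C₂ * Real.cos (K * t) + C₂)) • Kv + t • z₂
    let y : ℝ → (Fin 3 → ℝ) := fun t =>
      ((1 / (2 * K)) * (C₁ ^ 2 + C₂ ^ 2) * (t * K - Real.sin (K * t))) • Kv
        + ((1 / (2 * K)) * ((2 * C₁ - C₂ * K * t) * Real.sin (K * t)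
            - (C₁ * K * t + 2 * C₂) * Real.cos (K * t) + 2 * C₂ - t * C₁ * K)) • z₂
    let h₀ : ℝ → ℝ := fun t => K * (-C₁ * Real.sin (K * t) + C₂ * Real.cos (K * t))
    let h : ℝ → (Fin 3 → ℝ) := fun t =>
      (C₁ * Real.cos (K * t) + C₂ * Real.sin (K * t)) • Kv + z₂
    x 0 = 0 ∧ ℓ 0 = 0 ∧ y 0 = 0 ∧
    ∀ t : ℝ,
      HasDerivAt x (h₀ t) t ∧
      HasDerivAt ℓ (h t) t ∧
      HasDerivAt y ((1 / 2 : ℝ) • (x t • h t - h₀ t • ℓ t)) t := by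
  intro Kv z₂ x ℓ y h₀ h
  have hK0 : K ≠ 0 := hKpos.ne'
  refine ⟨by simp [x], by simp [ℓ], by simp [y], fun t => ?_⟩
  have hlin : HasDerivAt (fun t : ℝ => K * t) K t := by
    simpa using (hasDerivAt_id t).const_mul K
  have hsin := hlin.sin
  have hcos := hlin.cos
  refine ⟨?_, ?_, ?_⟩
  · refine (((hcos.const_mul C₁).add (hsin.const_mul C₂)).sub_const C₁).congr_deriv ?_
    simp only [h₀]
    ring
  · have hcoef := (((hsin.const_mul C₁).sub (hcos.const_mul C₂)).add_const C₂).const_mul (1 / K)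
    refine ((hcoef.smul_const Kv).add ((hasDerivAt_id t).smul_const z₂)).congr_deriv ?_
    simp only [h, one_smul]
    congr 2
    field_simp
    ring
  · have hKv := (((hasDerivAt_id t).mul_const K).sub hsin).const_mul
      ((1 / (2 * K)) * (C₁ ^ 2 + C₂ ^ 2))
    have hz₂ := ((((((hlin.const_mul C₂).const_sub (2 * C₁)).mul hsin).sub
      (((hlin.const_mul C₁).add_const (2 * C₂)).mul hcos)).add_const (2 * C₂)).sub
      ((hasDerivAt_id t).mul_const (C₁ * K))).const_mul (1 / (2 * K))
    refine HasDerivAt.congr_deriv (f := y) (((hKv.smul_const Kv).add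
      (hz₂.smul_const z₂)).congr_of_eventuallyEq (.of_forall fun s => ?_)) ?_
    · simp only [y, Pi.add_apply, Pi.sub_apply, Pi.mul_apply, id_eq]
      congr 2
      ring
    · ext i
      simp only [x, h, h₀, ℓ, Pi.add_apply, Pi.sub_apply, Pi.smul_apply, smul_eq_mul]
      field_simp
      linear_combination (Kv i * (C₁ ^ 2 + C₂ ^ 2)) * -Real.sin_sq_add_cos_sq (K * t)
end

section
/- Let K₁, K₂, K₃ ∈ ℝ with K = √(K₁² + K₂² + K₃²) > 0, let C₁, C₂, C₃, C₄ ∈ ℝ with (C₁, C₂) ≠ (0, 0), and set z₂ = (−C₃K₃ − C₄K₂, C₄K₁, C₃K₁) ∈ ℝ³. Define ℓ(t) = (1/K)(C₁ sin(Kt) − C₂ cos(Kt) + C₂)·(K₁,K₂,K₃) + t·z₂ and y(t) = (1/(2K))(C₁² + C₂²)(tK − sin(Kt))·(K₁,K₂,K₃) + (1/(2K))((2C₁ − C₂Kt) sin(Kt) − (C₁Kt + 2C₂) cos(Kt) + 2C₂ − tC₁K)·z₂. Then exactly one of the following holds: (i) z₂ = 0, and then ℓ(t) × y(t) = 0 (cross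 product in ℝ³) for every t ∈ ℝ, or (ii) z₂ ≠ 0, and then ℓ(t) × y(t) ≠ 0 for every t > 0. In particular, the corresponding sub-Riemannian geodesic starting at the origin either has ℓ(t) and y(t) linearly dependent for all times, or has ℓ(t) and y(t) linearly independent for all positive times. -/
open Matrix Real

/-- The Cusa–Huygens inequality, valid for all positive arguments. -/
theorem three_mul_sin_lt {s : ℝ} (hs : 0 < s) : 3 * sin s < s * (2 + cos s) := by
  rcases le_or_gt π s with hπ | hπ
  · rcases le_or_gt s 3 with h3 | h3
    · linarith [pi_gt_three]
    · nlinarith [sin_le_one s, neg_one_le_cos s]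
  · have hd (x : ℝ) : HasDerivAt (fun x => x * (2 + cos x) - 3 * sin x)
        (2 - 2 * cos x - x * sin x) x := by
      refine (((hasDerivAt_id x).mul ((hasDerivAt_cos x).const_add 2)).sub
        ((hasDerivAt_sin x).const_mul 3)).congr_deriv ?_
      simp only [id]
      ring
    have hmono : StrictMonoOn (fun x => x * (2 + cos x) - 3 * sin x) (Set.Icc 0 π) := by
      refine strictMonoOn_of_deriv_pos (convex_Icc 0 π)
        (fun x _ => (hd x).continuousAt.continuousWithinAt) fun x hx => ?_
      rw [interior_Icc] at hx
      rw [(hd x).deriv]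
      obtain ⟨h, rfl⟩ : ∃ h, x = 2 * h := ⟨x / 2, by ring⟩
      have h0 : 0 < h := by linarith [hx.1]
      have hlt : h < π / 2 := by linarith [hx.2]
      have hcos : 0 < cos h := cos_pos_of_mem_Ioo ⟨by linarith, hlt⟩
      have hsin : 0 < sin h := sin_pos_of_pos_of_lt_pi h0 (by linarith)
      have htan := lt_tan h0 hlt
      rw [tan_eq_sin_div_cos, lt_div_iff₀ hcos] at htan
      rw [sin_two_mul, cos_two_mul]
      nlinarith [mul_pos hsin (sub_pos.2 htan), sin_sq_add_cos_sq h]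
    have := hmono ⟨le_rfl, pi_pos.le⟩ ⟨hs.le, hπ.le⟩ hs
    simp at this
    linarith

theorem sq_add_mul_sin_add_cos_pos {s : ℝ} (hs : 0 < s) :
    0 < s ^ 2 + s * sin s + 4 * cos s - 4 := by
  have hd (x : ℝ) : HasDerivAt (fun x => x ^ 2 + x * sin x + 4 * cos x - 4)
      (x * (2 + cos x) - 3 * sin x) x := by
    refine ((((hasDerivAt_pow 2 x).add ((hasDerivAt_id x).mul (hasDerivAt_sin x))).add
      ((hasDerivAt_cos x).const_mul 4)).sub_const 4).congr_deriv ?_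
    simp only [id]
    ring
  have hmono : StrictMonoOn (fun x => x ^ 2 + x * sin x + 4 * cos x - 4) (Set.Ici 0) := by
    refine strictMonoOn_of_deriv_pos (convex_Ici 0)
      (fun x _ => (hd x).continuousAt.continuousWithinAt) fun x hx => ?_
    rw [interior_Ici] at hx
    rw [(hd x).deriv]
    exact sub_pos.2 (three_mul_sin_lt hx)
  have := hmono Set.self_mem_Ici hs.le hs
  simp at this
  linarith

theorem geodesic_coefficient_neg {a b s : ℝ} (hs : 0 < s) (hab : 0 < a ^ 2 + b ^ 2) :
    (a * sin s - b * cos s + b) *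
        ((2 * a - b * s) * sin s - (a * s + 2 * b) * cos s + 2 * b - s * a)
      - s * ((a ^ 2 + b ^ 2) * (s - sin s)) < 0 := by
  have hpos := sq_add_mul_sin_add_cos_pos hs
  have hsin := sin_lt hs
  obtain ⟨h, rfl⟩ : ∃ h, s = 2 * h := ⟨s / 2, by ring⟩
  have h0 : 0 < h := by linarith
  rw [sin_two_mul] at hsin
  rw [sin_two_mul, cos_two_mul] at hpos ⊢
  have hsq := sin_sq_add_cos_sq h
  set p := sin h
  set q := cos h
  have hu : (a * q + b * p) ^ 2 ≤ a ^ 2 + b ^ 2 := by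
    linear_combination sq_nonneg (a * p - b * q) + (a ^ 2 + b ^ 2) * hsq
  have hP : 0 < h ^ 2 - h * p * q := by nlinarith
  have hQ : 2 * p ^ 2 - 2 * h * p * q < h ^ 2 - h * p * q := by nlinarith
  have key : (a * q + b * p) ^ 2 * (2 * p ^ 2 - 2 * h * p * q)
      < (a ^ 2 + b ^ 2) * (h ^ 2 - h * p * q) := by
    rcases eq_or_ne (a * q + b * p) 0 with hu0 | hu0
    · rw [hu0]
      simpa using mul_pos hab hP
    · calc _ < (a * q + b * p) ^ 2 * (h ^ 2 - h * p * q) := by gcongr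
        _ ≤ _ := by gcongr
  have hA : a * (2 * p * q) - b * (2 * q ^ 2 - 1) + b = 2 * p * (a * q + b * p) := by
    linear_combination (-2 * b) * hsq
  have hD : (2 * a - b * (2 * h)) * (2 * p * q) - (a * (2 * h) + 2 * b) * (2 * q ^ 2 - 1)
      + 2 * b - 2 * h * a = 4 * (p - h * q) * (a * q + b * p) := by
    linear_combination (-4 * b) * hsq
  rw [hA, hD]
  linarith

theorem cross_smul_add_smul {R : Type*} [CommRing R] (a b c d : R) (u v : Fin 3 → R) :
    crossProduct (a • u + b • v) (c • u + d • v) = (a * d - b * c) • crossProduct u v := by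
  ext i
  fin_cases i <;> simp [cross_apply] <;> ring

theorem cross_ne_zero_of_dotProduct_eq_zero {u v : Fin 3 → ℝ} (hu : u ≠ 0) (hv : v ≠ 0)
    (huv : u ⬝ᵥ v = 0) : crossProduct u v ≠ 0 := by
  intro h
  have := cross_dot_cross u v u v
  rw [h, huv] at this
  simp_all

/-- Dichotomy for geodesics of the nilpotent (4,7) problem with nonconstant controls:
either `z₂ = 0` and then `ℓ(t)` and `y(t)` are collinear (zero cross product) for all times,
or `z₂ ≠ 0` and then `ℓ(t) × y(t) ≠ 0` for all positive times. Hence every such geodesic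
starting at the origin either lies in the fixed-point set `C_n` for all times or never
meets it at positive times. -/
theorem geodesic_dichotomy (K₁ K₂ K₃ C₁ C₂ C₃ C₄ K : ℝ)
    (hK : K = Real.sqrt (K₁ ^ 2 + K₂ ^ 2 + K₃ ^ 2)) (hKpos : 0 < K)
    (hC : (C₁, C₂) ≠ (0, 0)) :
    let Kv : Fin 3 → ℝ := ![K₁, K₂, K₃]
    let z₂ : Fin 3 → ℝ := ![-C₃ * K₃ - C₄ * K₂, C₄ * K₁, C₃ * K₁]
    let ℓ : ℝ → (Fin 3 → ℝ) := fun t =>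
      ((1 / K) * (C₁ * Real.sin (K * t) - C₂ * Real.cos (K * t) + C₂)) • Kv + t • z₂
    let y : ℝ → (Fin 3 → ℝ) := fun t =>
      ((1 / (2 * K)) * (C₁ ^ 2 + C₂ ^ 2) * (t * K - Real.sin (K * t))) • Kv
        + ((1 / (2 * K)) * ((2 * C₁ - C₂ * K * t) * Real.sin (K * t)
            - (C₁ * K * t + 2 * C₂) * Real.cos (K * t) + 2 * C₂ - t * C₁ * K)) • z₂
    (z₂ = 0 ∧ ∀ t : ℝ, crossProduct (ℓ t) (y t) = 0) ∨
    (z₂ ≠ 0 ∧ ∀ t : ℝ, 0 < t → crossProduct (ℓ t) (y t) ≠ 0) := by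
  intro Kv z₂ ℓ y
  have hKv : Kv ≠ 0 := by
    intro h
    have h₁ : K₁ = 0 := congrFun h 0
    have h₂ : K₂ = 0 := congrFun h 1
    have h₃ : K₃ = 0 := congrFun h 2
    simp [hK, h₁, h₂, h₃] at hKpos
  have horth : Kv ⬝ᵥ z₂ = 0 := by
    simp [Kv, z₂, dotProduct, Fin.sum_univ_three]
    ring
  have hC' : 0 < C₁ ^ 2 + C₂ ^ 2 := by
    by_contra! h
    exact hC (Prod.ext (by nlinarith [sq_nonneg C₁, sq_nonneg C₂])
      (by nlinarith [sq_nonneg C₁, sq_nonneg C₂]))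
  by_cases hz : z₂ = 0
  · exact .inl ⟨hz, fun t => by simp [ℓ, y, hz]⟩
  · refine .inr ⟨hz, fun t ht => ?_⟩
    simp only [ℓ, y]
    rw [cross_smul_add_smul]
    refine smul_ne_zero ?_ (cross_ne_zero_of_dotProduct_eq_zero hKv hz horth)
    have hneg := geodesic_coefficient_neg (mul_pos hKpos ht) hC'
    intro h
    refine hneg.ne ?_
    field_simp at h
    linear_combination h
end

section
/- For all τ ∈ ℝ, with A(τ) = 2 sin τ − τ cos τ − τ and B(τ) = 2 − 2 cos τ − τ sin τ, and with D₁(τ) = sin τ · A(τ) − τ(τ − sin τ), D₂(τ) = sin τ · B(τ) + (1 − cos τ) · A(τ), D₃(τ) = (1 − cos τ) · B(τ) − τ(τ − sin τ), the following identity holds: D₂(τ)² − 4·D₁(τ)·D₃(τ) = −4τ(τ − sin τ)(τ² + τ sin τ + 4 cos τ − 4). Consequently, for every τ > 0 the discriminant D₂(τ)² − 4·D₁(τ)·D₃(τ) is negative provided τ² + τ sin τ + 4 cos τ − 4 > 0. -/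
open Real

/-- `A(τ) = 2 sin τ − τ cos τ − τ`. -/
noncomputable def Acoef (τ : ℝ) : ℝ := 2 * Real.sin τ - τ * Real.cos τ - τ

/-- `B(τ) = 2 − 2 cos τ − τ sin τ`. -/
noncomputable def Bcoef (τ : ℝ) : ℝ := 2 - 2 * Real.cos τ - τ * Real.sin τ

/-- `D₁(τ) = sin τ · A(τ) − τ(τ − sin τ)`. -/
noncomputable def D₁ (τ : ℝ) : ℝ := Real.sin τ * Acoef τ - τ * (τ - Real.sin τ)

/-- `D₂(τ) = sin τ · B(τ) + (1 − cos τ) · A(τ)`. -/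
noncomputable def D₂ (τ : ℝ) : ℝ := Real.sin τ * Bcoef τ + (1 - Real.cos τ) * Acoef τ

/-- `D₃(τ) = (1 − cos τ) · B(τ) − τ(τ − sin τ)`. -/
noncomputable def D₃ (τ : ℝ) : ℝ := (1 - Real.cos τ) * Bcoef τ - τ * (τ - Real.sin τ)

/-- The discriminant identity
`D₂² − 4D₁D₃ = −4τ(τ − sin τ)(τ² + τ sin τ + 4 cos τ − 4)`; consequently for `τ > 0`
the discriminant is negative provided `τ² + τ sin τ + 4 cos τ − 4 > 0`. -/
theorem discriminant_identity :
    (∀ τ : ℝ,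
      D₂ τ ^ 2 - 4 * D₁ τ * D₃ τ =
        -4 * τ * (τ - Real.sin τ) * (τ ^ 2 + τ * Real.sin τ + 4 * Real.cos τ - 4)) ∧
    (∀ τ : ℝ, 0 < τ → 0 < τ ^ 2 + τ * Real.sin τ + 4 * Real.cos τ - 4 →
      D₂ τ ^ 2 - 4 * D₁ τ * D₃ τ < 0) := by
  have identity : ∀ τ : ℝ,
      D₂ τ ^ 2 - 4 * D₁ τ * D₃ τ =
        -4 * τ * (τ - Real.sin τ) * (τ ^ 2 + τ * Real.sin τ + 4 * Real.cos τ - 4) := by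
    intro τ
    have h := Real.sin_sq_add_cos_sq τ
    have hdiff : Real.sin τ * Bcoef τ - (1 - Real.cos τ) * Acoef τ = 0 := by
      unfold Acoef Bcoef
      linear_combination -τ * h
    have hsum : Real.sin τ * Acoef τ + (1 - Real.cos τ) * Bcoef τ =
        4 - 4 * Real.cos τ - 2 * τ * Real.sin τ := by
      unfold Acoef Bcoef
      linear_combination 2 * h
    unfold D₁ D₂ D₃
    linear_combination (Real.sin τ * Bcoef τ - (1 - Real.cos τ) * Acoef τ) * hdiff +
      4 * τ * (τ - Real.sin τ) * hsum
  refine ⟨identity, fun τ hτ hpos => ?_⟩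
  have hsin : 0 < τ - Real.sin τ := sub_pos.mpr (Real.sin_lt hτ)
  rw [identity]
  have := mul_pos (mul_pos hτ hsin) hpos
  linarith
end

section
/- For every real τ > 0, the function f(τ) = τ² + τ sin τ + 4 cos τ − 4 is strictly positive. -/
/-- A function vanishing at `0` with nonnegative derivative on `[0, ∞)` is nonnegative there. -/
theorem nonneg_of_hasDerivAt_nonneg {g g' : ℝ → ℝ} (h0 : g 0 = 0)
    (hg : ∀ x, HasDerivAt g (g' x) x) (hg' : ∀ x, 0 ≤ x → 0 ≤ g' x) {x : ℝ} (hx : 0 ≤ x) :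
    0 ≤ g x := by
  have hmono : MonotoneOn g (Set.Ici 0) := by
    refine monotoneOn_of_hasDerivWithinAt_nonneg (convex_Ici 0)
      (fun y _ => (hg y).continuousAt.continuousWithinAt)
      (fun y _ => (hg y).hasDerivWithinAt) fun y hy => hg' y (interior_subset hy)
  simpa [h0] using hmono Set.self_mem_Ici hx hx

theorem cos_le_taylor_four {x : ℝ} (hx : 0 ≤ x) :
    Real.cos x ≤ 1 - x ^ 2 / 2 + x ^ 4 / 24 := by
  have h := nonneg_of_hasDerivAt_nonneg (g := fun y => 1 - y ^ 2 / 2 + y ^ 4 / 24 - Real.cos y)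
    (g' := fun y => Real.sin y - (y - y ^ 3 / 6)) (by simp)
    (fun y => by
      convert! ((((hasDerivAt_id y).pow 2).div_const 2).const_sub 1 |>.add
        (((hasDerivAt_id y).pow 4).div_const 24)).sub (Real.hasDerivAt_cos y) using 1
      simp; ring)
    (fun y hy => by
      rcases hy.eq_or_lt with rfl | hy
      · simp
      · linarith [Real.sin_gt_sub_cube hy]) hx
  linarith

theorem sin_le_taylor_five {x : ℝ} (hx : 0 ≤ x) :
    Real.sin x ≤ x - x ^ 3 / 6 + x ^ 5 / 120 := by
  have h := nonneg_of_hasDerivAt_nonneg (g := fun y => y - y ^ 3 / 6 + y ^ 5 / 120 - Real.sin y)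
    (g' := fun y => 1 - y ^ 2 / 2 + y ^ 4 / 24 - Real.cos y) (by simp)
    (fun y => by
      convert! (((hasDerivAt_id y).sub (((hasDerivAt_id y).pow 3).div_const 6)).add
        (((hasDerivAt_id y).pow 5).div_const 120)).sub (Real.hasDerivAt_sin y) using 1
      simp; ring)
    (fun y hy => by linarith [cos_le_taylor_four hy]) hx
  linarith

theorem taylor_six_le_cos {x : ℝ} (hx : 0 ≤ x) :
    1 - x ^ 2 / 2 + x ^ 4 / 24 - x ^ 6 / 720 ≤ Real.cos x := by
  have h := nonneg_of_hasDerivAt_nonneg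
    (g := fun y => Real.cos y - (1 - y ^ 2 / 2 + y ^ 4 / 24 - y ^ 6 / 720))
    (g' := fun y => y - y ^ 3 / 6 + y ^ 5 / 120 - Real.sin y) (by simp)
    (fun y => by
      convert! (Real.hasDerivAt_cos y).sub (((((hasDerivAt_id y).pow 2).div_const 2).const_sub 1
        |>.add (((hasDerivAt_id y).pow 4).div_const 24)).sub
        (((hasDerivAt_id y).pow 6).div_const 720)) using 1
      simp; ring)
    (fun y hy => by linarith [sin_le_taylor_five hy]) hx
  linarith

theorem taylor_seven_le_sin {x : ℝ} (hx : 0 ≤ x) :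
    x - x ^ 3 / 6 + x ^ 5 / 120 - x ^ 7 / 5040 ≤ Real.sin x := by
  have h := nonneg_of_hasDerivAt_nonneg
    (g := fun y => Real.sin y - (y - y ^ 3 / 6 + y ^ 5 / 120 - y ^ 7 / 5040))
    (g' := fun y => Real.cos y - (1 - y ^ 2 / 2 + y ^ 4 / 24 - y ^ 6 / 720)) (by simp)
    (fun y => by
      convert! (Real.hasDerivAt_sin y).sub
        (((hasDerivAt_id y).sub (((hasDerivAt_id y).pow 3).div_const 6)).add
        (((hasDerivAt_id y).pow 5).div_const 120) |>.sub
        (((hasDerivAt_id y).pow 7).div_const 5040)) using 1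
      simp; ring)
    (fun y hy => by linarith [taylor_six_le_cos hy]) hx
  linarith

/-- For every `τ > 0`, the function `f(τ) = τ² + τ sin τ + 4 cos τ − 4` is strictly
positive. -/
theorem f_positive :
    ∀ τ : ℝ, 0 < τ → 0 < τ ^ 2 + τ * Real.sin τ + 4 * Real.cos τ - 4 := by
  intro τ hτ
  rcases le_total τ (7 / 2) with h | h
  · have hs := mul_le_mul_of_nonneg_left (taylor_seven_le_sin hτ.le) hτ.le
    have hc := taylor_six_le_cos hτ.le
    have hp : 0 < τ ^ 6 * (14 - τ ^ 2) := mul_pos (by positivity) (by nlinarith)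
    linear_combination hs + 4 * hc + hp / 5040
  · nlinarith [Real.neg_one_le_sin τ, Real.neg_one_le_cos τ]
end

section
/- For every real τ > 0, the function f(τ) = τ² + τ sin τ + 4 cos τ − 4 satisfies f(τ) > −τ⁶(τ² − 14)/5040, i.e. f(τ) > τ⁶(14 − τ²)/5040. In particular f(τ) > 0 for 0 < τ < √14. -/
/-- A function vanishing at `0` with positive derivative on `(0, ∞)` is positive on `(0, ∞)`. -/
theorem pos_of_hasDerivAt_pos {g g' : ℝ → ℝ} (hg : ∀ x, HasDerivAt g (g' x) x) (h0 : g 0 = 0)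
    (hpos : ∀ x, 0 < x → 0 < g' x) {x : ℝ} (hx : 0 < x) : 0 < g x := by
  have hmono : StrictMonoOn g (Set.Ici 0) := by
    refine strictMonoOn_of_deriv_pos (convex_Ici 0)
      (fun y _ => (hg y).continuousAt.continuousWithinAt) fun y hy => ?_
    rw [interior_Ici] at hy
    rw [(hg y).deriv]
    exact hpos y hy
  simpa only [h0] using hmono Set.self_mem_Ici hx.le hx

theorem cos_lt_quartic {x : ℝ} (hx : 0 < x) :
    Real.cos x < 1 - x ^ 2 / 2 + x ^ 4 / 24 := by
  refine sub_pos.1 (pos_of_hasDerivAt_pos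
    (g := fun x => 1 - x ^ 2 / 2 + x ^ 4 / 24 - Real.cos x)
    (g' := fun x => Real.sin x - (x - x ^ 3 / 6))
    (fun x => ?_) (by simp) (fun x hx => sub_pos.2 (Real.sin_gt_sub_cube hx)) hx)
  refine HasDerivAt.congr_deriv
      ((((hasDerivAt_const x (1 : ℝ)).sub ((hasDerivAt_pow 2 x).div_const 2)).add
      ((hasDerivAt_pow 4 x).div_const 24)).sub
      (Real.hasDerivAt_cos x)) ?_
  norm_num
  ring

theorem sin_lt_quintic {x : ℝ} (hx : 0 < x) :
    Real.sin x < x - x ^ 3 / 6 + x ^ 5 / 120 := by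
  refine sub_pos.1 (pos_of_hasDerivAt_pos
    (g := fun x => x - x ^ 3 / 6 + x ^ 5 / 120 - Real.sin x)
    (g' := fun x => (1 - x ^ 2 / 2 + x ^ 4 / 24) - Real.cos x)
    (fun x => ?_) (by simp) (fun x hx => sub_pos.2 (cos_lt_quartic hx)) hx)
  refine HasDerivAt.congr_deriv
      ((((hasDerivAt_id x).sub ((hasDerivAt_pow 3 x).div_const 6)).add
      ((hasDerivAt_pow 5 x).div_const 120)).sub
      (Real.hasDerivAt_sin x)) ?_
  norm_num
  ring

theorem sextic_lt_cos {x : ℝ} (hx : 0 < x) :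
    1 - x ^ 2 / 2 + x ^ 4 / 24 - x ^ 6 / 720 < Real.cos x := by
  refine sub_pos.1 (pos_of_hasDerivAt_pos
    (g := fun x => Real.cos x - (1 - x ^ 2 / 2 + x ^ 4 / 24 - x ^ 6 / 720))
    (g' := fun x => (x - x ^ 3 / 6 + x ^ 5 / 120) - Real.sin x)
    (fun x => ?_) (by simp) (fun x hx => sub_pos.2 (sin_lt_quintic hx)) hx)
  refine HasDerivAt.congr_deriv ((Real.hasDerivAt_cos x).sub
      ((((hasDerivAt_const x (1 : ℝ)).sub ((hasDerivAt_pow 2 x).div_const 2)).add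
      ((hasDerivAt_pow 4 x).div_const 24)).sub ((hasDerivAt_pow 6 x).div_const 720))) ?_
  norm_num
  ring

theorem septic_lt_sin {x : ℝ} (hx : 0 < x) :
    x - x ^ 3 / 6 + x ^ 5 / 120 - x ^ 7 / 5040 < Real.sin x := by
  refine sub_pos.1 (pos_of_hasDerivAt_pos
    (g := fun x => Real.sin x - (x - x ^ 3 / 6 + x ^ 5 / 120 - x ^ 7 / 5040))
    (g' := fun x => Real.cos x - (1 - x ^ 2 / 2 + x ^ 4 / 24 - x ^ 6 / 720))
    (fun x => ?_) (by simp) (fun x hx => sub_pos.2 (sextic_lt_cos hx)) hx)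
  refine HasDerivAt.congr_deriv ((Real.hasDerivAt_sin x).sub
      ((((hasDerivAt_id x).sub ((hasDerivAt_pow 3 x).div_const 6)).add
      ((hasDerivAt_pow 5 x).div_const 120)).sub ((hasDerivAt_pow 7 x).div_const 5040))) ?_
  norm_num
  ring

/-- The local (Taylor) estimate: for every `τ > 0`,
`f(τ) = τ² + τ sin τ + 4 cos τ − 4 > τ⁶(14 − τ²)/5040`; in particular `f(τ) > 0` for
`0 < τ < √14`. -/
theorem f_local_estimate :
    (∀ τ : ℝ, 0 < τ →
      τ ^ 2 + τ * Real.sin τ + 4 * Real.cos τ - 4 > τ ^ 6 * (14 - τ ^ 2) / 5040) ∧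
    (∀ τ : ℝ, 0 < τ → τ < Real.sqrt 14 →
      0 < τ ^ 2 + τ * Real.sin τ + 4 * Real.cos τ - 4) := by
  have hmain : ∀ τ : ℝ, 0 < τ →
      τ ^ 2 + τ * Real.sin τ + 4 * Real.cos τ - 4 > τ ^ 6 * (14 - τ ^ 2) / 5040 := by
    intro τ hτ
    have hs := mul_lt_mul_of_pos_left (septic_lt_sin hτ) hτ
    have hc := sextic_lt_cos hτ
    linarith
  refine ⟨hmain, fun τ hτ hlt => lt_trans ?_ (hmain τ hτ)⟩
  have hsq : τ ^ 2 < 14 := (Real.lt_sqrt hτ.le).1 hlt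
  have : 0 < 14 - τ ^ 2 := sub_pos.2 hsq
  positivity
end
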